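/- Let $\Delta$ be a finite polytopal complex which is the face complex of an $n$-dimensional polytope, and fix a vertex $v$. For each face $\tau$ containing $v$, define $\tau^\perp := \{\sigma \in \Delta : \sigma \subseteq \tau,\ \sigma \not\subseteq \rho \text{ for every proper face } \rho \subsetneq \tau \text{ with } v \in \rho\}$. Then the sets $\tau^\perp$, as $\tau$ ranges over faces containing $v$, partition $\Delta$, and the Euler characteristic $\chi(\tau^\perp) := \sum_{\sigma \in \tau^\perp} (-1)^{\dim \sigma}$ equals $0$ unless $\tau = \{v\}$, in which case it equals $1$. -/

import Mathlib

open scoped Classical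

open Module

/-- The dimension of a polytope (or face) `σ`: the rank of its direction space. -/
noncomputable def faceDim {n : ℕ} (σ : Set (EuclideanSpace ℝ (Fin n))) : ℕ :=
  Module.finrank ℝ (vectorSpan ℝ σ)

/-- A (nonempty) face of a polytope `P`: a nonempty closed convex extreme subset. -/
def IsPolyFace {n : ℕ} (P F : Set (EuclideanSpace ℝ (Fin n))) : Prop :=
  F.Nonempty ∧ IsExtreme ℝ P F ∧ Convex ℝ F ∧ IsClosed F

/-- For a face `τ` containing the vertex `v`, the set
`τ^⊥ = {σ ∈ Δ : σ ⊆ τ, σ ⊄ ρ for every proper face ρ ⊊ τ with v ∈ ρ}`. -/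
noncomputable def vertexPerp {n : ℕ} (Δ : Finset (Set (EuclideanSpace ℝ (Fin n))))
    (v : EuclideanSpace ℝ (Fin n)) (τ : Set (EuclideanSpace ℝ (Fin n))) :
    Finset (Set (EuclideanSpace ℝ (Fin n))) :=
  @Finset.filter _
    (fun σ => σ ⊆ τ ∧ ∀ ρ ∈ Δ, ρ ⊆ τ → ρ ≠ τ → v ∈ ρ → ¬ σ ⊆ ρ)
    (Classical.decPred _) Δ

section EulerIntegral

open Filter Topology

/-- `HasEulerIntegral g c` says that the jumps `g t - g (t⁺)` of `g : ℝ → ℤ` sum to `c`. -/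
def HasEulerIntegral (g : ℝ → ℤ) (c : ℤ) : Prop :=
  ∃ T₀ : Finset ℝ, ∀ T : Finset ℝ, T₀ ⊆ T →
    ∀ᶠ ε in 𝓝[>] (0 : ℝ), ∑ t ∈ T, (g t - g (t + ε)) = c

theorem HasEulerIntegral.unique {g : ℝ → ℤ} {c d : ℤ} (hc : HasEulerIntegral g c)
    (hd : HasEulerIntegral g d) : c = d := by
  obtain ⟨T₁, h₁⟩ := hc
  obtain ⟨T₂, h₂⟩ := hd
  obtain ⟨ε, e₁, e₂⟩ := ((h₁ (T₁ ∪ T₂) Finset.subset_union_left).and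
    (h₂ (T₁ ∪ T₂) Finset.subset_union_right)).exists
  exact e₁.symm.trans e₂

theorem HasEulerIntegral.sum {ι : Type*} {s : Finset ι} {g : ι → ℝ → ℤ} {c : ι → ℤ}
    (h : ∀ i ∈ s, HasEulerIntegral (g i) (c i)) :
    HasEulerIntegral (fun t => ∑ i ∈ s, g i t) (∑ i ∈ s, c i) := by
  choose! T₀ hT₀ using h
  refine ⟨s.biUnion T₀, fun T hT => ?_⟩
  have key : ∀ᶠ ε in 𝓝[>] (0 : ℝ), ∀ i ∈ s, ∑ t ∈ T, (g i t - g i (t + ε)) = c i :=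
    (eventually_all_finset s).2 fun i hi =>
      hT₀ i hi T ((Finset.subset_biUnion_of_mem T₀ hi).trans hT)
  filter_upwards [key] with ε hε
  rw [← Finset.sum_congr rfl hε, Finset.sum_comm]
  simp only [Finset.sum_sub_distrib]

theorem hasEulerIntegral_of_single_jump {g : ℝ → ℤ} {c : ℤ} (b : ℝ)
    (h : ∀ t, ∀ᶠ ε in 𝓝[>] (0 : ℝ), g t - g (t + ε) = if t = b then c else 0) :
    HasEulerIntegral g c := by
  refine ⟨{b}, fun T hT => ?_⟩
  filter_upwards [(eventually_all_finset T).2 fun t _ => h t] with ε hε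
  rw [Finset.sum_congr rfl hε, Finset.sum_ite_eq', if_pos (hT (Finset.mem_singleton_self b))]

theorem eventually_nhdsGT_zero_add_lt {t a : ℝ} (h : t < a) :
    ∀ᶠ ε in 𝓝[>] (0 : ℝ), 0 < ε ∧ t + ε < a := by
  filter_upwards [Ioo_mem_nhdsGT (sub_pos.2 h)] with ε hε
  exact ⟨hε.1, by linarith [hε.2]⟩

theorem hasEulerIntegral_Icc {a b : ℝ} (hab : a ≤ b) (c : ℤ) :
    HasEulerIntegral (fun t => if a ≤ t ∧ t ≤ b then c else 0) c := by
  refine hasEulerIntegral_of_single_jump b fun t => ?_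
  rcases lt_or_ge t a with ha | ha
  · filter_upwards [eventually_nhdsGT_zero_add_lt ha] with ε hε
    grind
  rcases lt_or_ge t b with hb | hb
  · filter_upwards [eventually_nhdsGT_zero_add_lt hb] with ε hε
    grind
  · filter_upwards [self_mem_nhdsWithin] with ε (hε : 0 < ε)
    grind

theorem hasEulerIntegral_Ioo {a b : ℝ} (hab : a < b) (c : ℤ) :
    HasEulerIntegral (fun t => if a < t ∧ t < b then c else 0) (-c) := by
  refine hasEulerIntegral_of_single_jump a fun t => ?_
  rcases lt_or_ge t a with ha | ha
  · filter_upwards [eventually_nhdsGT_zero_add_lt ha] with ε hε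
    grind
  rcases lt_or_ge t b with hb | hb
  · filter_upwards [eventually_nhdsGT_zero_add_lt hb] with ε hε
    grind
  · filter_upwards [self_mem_nhdsWithin] with ε (hε : 0 < ε)
    grind

end EulerIntegral

section RelInterior

variable {E : Type*} [AddCommGroup E] [Module ℝ E]

/-- The points `x` of `C` such that every segment in `C` ending at `x` can be prolonged in `C`
beyond `x`. -/
def algRelInterior (C : Set E) : Set E :=
  {x | x ∈ C ∧ ∀ y ∈ C, ∃ ε : ℝ, 0 < ε ∧ x + ε • (x - y) ∈ C}

theorem algRelInterior_subset (C : Set E) : algRelInterior C ⊆ C := fun _ hx => hx.1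

theorem Convex.add_smul_mem_of_le {C : Set E} (hC : Convex ℝ C) {x w : E} {δ ε : ℝ} (hx : x ∈ C)
    (hε : 0 < ε) (hw : x + ε • w ∈ C) (hδ : 0 ≤ δ) (hle : δ ≤ ε) : x + δ • w ∈ C := by
  have := hC.add_smul_mem hx hw (t := δ / ε) ⟨by positivity, (div_le_one hε).2 hle⟩
  rwa [smul_smul, div_mul_cancel₀ _ hε.ne'] at this

theorem Convex.convex_algRelInterior {C : Set E} (hC : Convex ℝ C) : Convex ℝ (algRelInterior C) := by
  intro x hx z hz a b ha hb hab
  refine ⟨hC hx.1 hz.1 ha hb hab, fun y hy => ?_⟩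
  obtain ⟨ε, hε, hxε⟩ := hx.2 y hy
  obtain ⟨δ, hδ, hzδ⟩ := hz.2 y hy
  refine ⟨min ε δ, lt_min hε hδ, ?_⟩
  have h₁ := hC.add_smul_mem_of_le hx.1 hε hxε (lt_min hε hδ).le (min_le_left _ _)
  have h₂ := hC.add_smul_mem_of_le hz.1 hδ hzδ (lt_min hε hδ).le (min_le_right _ _)
  convert hC h₁ h₂ ha hb hab using 1
  obtain rfl : b = 1 - a := by linarith
  module

theorem Convex.midpoint_mem_algRelInterior {C : Set E} (hC : Convex ℝ C) {x z : E}
    (hx : x ∈ algRelInterior C) (hz : z ∈ C) :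
    (1 / 2 : ℝ) • x + (1 / 2 : ℝ) • z ∈ algRelInterior C := by
  refine ⟨hC hx.1 hz (by norm_num) (by norm_num) (by norm_num), fun y hy => ?_⟩
  obtain ⟨ε, hε, hp⟩ := hx.2 y hy
  refine ⟨ε / (2 + ε), by positivity, ?_⟩
  convert hC hp hz (a := 1 / (2 + ε)) (b := (1 + ε) / (2 + ε)) (by positivity) (by positivity)
    (by field_simp; ring) using 1
  match_scalars <;> field_simp <;> ring

theorem Convex.algRelInterior_subset_algRelInterior {C : Set E} (hC : Convex ℝ C) :
    algRelInterior C ⊆ algRelInterior (algRelInterior C) := by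
  refine fun x hx => ⟨hx, fun y hy => ?_⟩
  obtain ⟨ε, hε, hp⟩ := hx.2 y hy.1
  refine ⟨ε / 2, by positivity, ?_⟩
  convert hC.midpoint_mem_algRelInterior hx hp using 1
  module

theorem Convex.vectorSpan_algRelInterior {C : Set E} (hC : Convex ℝ C)
    (hne : (algRelInterior C).Nonempty) :
    vectorSpan ℝ (algRelInterior C) = vectorSpan ℝ C := by
  obtain ⟨x, hx⟩ := hne
  refine le_antisymm (vectorSpan_mono ℝ (algRelInterior_subset C)) ?_
  rw [vectorSpan_eq_span_vsub_set_right ℝ hx.1, Submodule.span_le]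
  rintro _ ⟨y, hy, rfl⟩
  have hyx : y -ᵥ x = (2 : ℝ) • (((1 / 2 : ℝ) • x + (1 / 2 : ℝ) • y) -ᵥ x) := by
    simp only [vsub_eq_sub]
    module
  simp only [SetLike.mem_coe, hyx]
  exact Submodule.smul_mem _ _
    (vsub_mem_vectorSpan ℝ (hC.midpoint_mem_algRelInterior hx hy) hx)

theorem exists_mem_algRelInterior_convexHull (S : Finset E) (hS : S.Nonempty) :
    (algRelInterior (convexHull ℝ (S : Set E))).Nonempty := by
  have hpos : (0 : ℝ) < S.card := by exact_mod_cast hS.card_pos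
  have hc : ∑ s ∈ S, (S.card : ℝ)⁻¹ = 1 := by
    rw [Finset.sum_const, nsmul_eq_mul, mul_inv_cancel₀ hpos.ne']
  refine ⟨∑ s ∈ S, (S.card : ℝ)⁻¹ • s, Finset.mem_convexHull'.2
    ⟨fun _ => (S.card : ℝ)⁻¹, fun _ _ => by positivity, hc, rfl⟩, fun y hy => ?_⟩
  obtain ⟨w, hw, hw1, rfl⟩ := Finset.mem_convexHull'.1 hy
  refine ⟨(S.card : ℝ)⁻¹, by positivity, Finset.mem_convexHull'.2
    ⟨fun s => (S.card : ℝ)⁻¹ + (S.card : ℝ)⁻¹ * ((S.card : ℝ)⁻¹ - w s), fun s hs => ?_, ?_, ?_⟩⟩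
  · have : w s ≤ 1 := hw1 ▸ Finset.single_le_sum hw hs
    have h0 : 0 < (S.card : ℝ)⁻¹ := by positivity
    nlinarith
  · rw [Finset.sum_add_distrib, ← Finset.mul_sum, Finset.sum_sub_distrib, hc, hw1]
    ring
  · rw [← Finset.sum_sub_distrib, Finset.smul_sum, ← Finset.sum_add_distrib]
    exact Finset.sum_congr rfl fun s _ => by module

/-- In a relatively open convex set one can move a little in every direction of its span. -/
theorem Convex.exists_add_smul_mem {C : Set E} (hC : Convex ℝ C)
    (hopen : C ⊆ algRelInterior C) {x w : E} (hx : x ∈ C) (hw : w ∈ vectorSpan ℝ C) :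
    ∃ ε : ℝ, 0 < ε ∧ x + ε • w ∈ C := by
  rw [vectorSpan_eq_span_vsub_set_right ℝ hx] at hw
  have hneg : ∀ u : E, (∃ ε : ℝ, 0 < ε ∧ x + ε • u ∈ C) → ∃ ε : ℝ, 0 < ε ∧ x + ε • (-u) ∈ C := by
    rintro u ⟨ε, hε, hu⟩
    obtain ⟨δ, hδ, h⟩ := (hopen hx).2 _ hu
    refine ⟨δ * ε, by positivity, ?_⟩
    convert h using 1
    module
  induction hw using Submodule.span_induction with
  | mem u hu =>
    obtain ⟨y, hy, rfl⟩ := hu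
    exact ⟨1, one_pos, by simpa using hy⟩
  | zero => exact ⟨1, one_pos, by simpa using hx⟩
  | add u₁ u₂ _ _ h₁ h₂ =>
    obtain ⟨ε, hε, h₁⟩ := h₁
    obtain ⟨δ, hδ, h₂⟩ := h₂
    have hm := lt_min hε hδ
    refine ⟨min ε δ / 2, by positivity, ?_⟩
    convert hC (hC.add_smul_mem_of_le hx hε h₁ hm.le (min_le_left _ _))
      (hC.add_smul_mem_of_le hx hδ h₂ hm.le (min_le_right _ _))
      (a := 1 / 2) (b := 1 / 2) (by norm_num) (by norm_num) (by norm_num) using 1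
    module
  | smul a u _ h =>
    have hposs : ∀ b : ℝ, 0 < b → ∀ u : E, (∃ ε : ℝ, 0 < ε ∧ x + ε • u ∈ C) →
        ∃ ε : ℝ, 0 < ε ∧ x + ε • (b • u) ∈ C := by
      rintro b hb u ⟨ε, hε, hu⟩
      refine ⟨ε / b, by positivity, ?_⟩
      rwa [smul_smul, div_mul_cancel₀ _ hb.ne']
    rcases lt_trichotomy a 0 with ha | rfl | ha
    · simpa using hneg _ (hposs (-a) (neg_pos.2 ha) u h)
    · exact ⟨1, one_pos, by simpa using hx⟩
    · exact hposs a ha u h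

theorem Convex.inter_fiber {C : Set E} (hC : Convex ℝ C) (l : E →ₗ[ℝ] ℝ) (t : ℝ) :
    Convex ℝ (C ∩ {x | l x = t}) :=
  hC.inter (convex_hyperplane l.isLinear t)

theorem inter_fiber_subset_algRelInterior {C : Set E} (hopen : C ⊆ algRelInterior C)
    (l : E →ₗ[ℝ] ℝ) (t : ℝ) :
    C ∩ {x | l x = t} ⊆ algRelInterior (C ∩ {x | l x = t}) := by
  refine fun x hx => ⟨hx, fun y hy => ?_⟩
  obtain ⟨ε, hε, h⟩ := (hopen hx.1).2 y hy.1
  refine ⟨ε, hε, h, ?_⟩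
  have h₁ : l x = t := hx.2
  have h₂ : l y = t := hy.2
  simp [h₁, h₂]

theorem vectorSpan_inter_fiber_le (C : Set E) (l : E →ₗ[ℝ] ℝ) (t : ℝ) :
    vectorSpan ℝ (C ∩ {x | l x = t}) ≤ vectorSpan ℝ C ⊓ LinearMap.ker l := by
  refine le_inf (vectorSpan_mono ℝ Set.inter_subset_left) ?_
  rw [vectorSpan, Submodule.span_le]
  rintro _ ⟨x, hx, y, hy, rfl⟩
  have h₁ : l x = t := hx.2
  have h₂ : l y = t := hy.2
  simp [h₁, h₂]

theorem Convex.vectorSpan_inter_fiber {C : Set E} (hC : Convex ℝ C)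
    (hopen : C ⊆ algRelInterior C) (l : E →ₗ[ℝ] ℝ) {t : ℝ}
    (hne : (C ∩ {x | l x = t}).Nonempty) :
    vectorSpan ℝ (C ∩ {x | l x = t}) = vectorSpan ℝ C ⊓ LinearMap.ker l := by
  refine le_antisymm (vectorSpan_inter_fiber_le C l t) ?_
  rintro w ⟨hw, hl : l w = 0⟩
  obtain ⟨x, hx⟩ := hne
  obtain ⟨ε, hε, h⟩ := hC.exists_add_smul_mem hopen hx.1 hw
  have hx' : l x = t := hx.2
  have h' : x + ε • w ∈ C ∩ {x | l x = t} := ⟨h, by simp [hl, hx']⟩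
  have := Submodule.smul_mem _ ε⁻¹ (vsub_mem_vectorSpan ℝ h' hx)
  simpa [smul_smul, hε.ne'] using this

theorem finrank_inf_ker_add_one [FiniteDimensional ℝ E] (W : Submodule ℝ E) (l : E →ₗ[ℝ] ℝ)
    {w : E} (hw : w ∈ W) (hl : l w ≠ 0) :
    Module.finrank ℝ (W ⊓ LinearMap.ker l : Submodule ℝ E) + 1 = Module.finrank ℝ W := by
  have hne : l.domRestrict W ≠ 0 := fun h => hl (by simpa using LinearMap.congr_fun h ⟨w, hw⟩)
  rw [← Module.Dual.finrank_ker_add_one_of_ne_zero hne, LinearMap.ker_domRestrict,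
    ← Submodule.map_comap_subtype, Submodule.finrank_map_subtype_eq]

end RelInterior

section EulerRelation

/-- The Euler characteristic of a relatively open convex set. -/
noncomputable def relOpenEuler {E : Type*} [AddCommGroup E] [Module ℝ E] (C : Set E) : ℤ :=
  if C.Nonempty then (-1) ^ Module.finrank ℝ (vectorSpan ℝ C) else 0

theorem hasEulerIntegral_relOpenEuler_fiber {E : Type*} [AddCommGroup E] [Module ℝ E]
    [FiniteDimensional ℝ E] {C : Set E} (hC : Convex ℝ C) (hopen : C ⊆ algRelInterior C)
    (l : E →ₗ[ℝ] ℝ) (hb : BddBelow (l '' C)) (ha : BddAbove (l '' C)) :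
    HasEulerIntegral (fun t => relOpenEuler (C ∩ {x | l x = t})) (relOpenEuler C) := by
  rcases C.eq_empty_or_nonempty with rfl | ⟨x, hx⟩
  · convert hasEulerIntegral_Icc le_rfl (0 : ℤ) (a := 0) using 1 <;> simp [relOpenEuler]
  by_cases hconst : ∀ y ∈ C, l y = l x
  · convert hasEulerIntegral_Icc (le_refl (l x)) (relOpenEuler C) using 2 with t
    split_ifs with ht
    · congr 1
      exact Set.inter_eq_left.2 fun y hy => (hconst y hy).trans (le_antisymm ht.1 ht.2)
    · rw [relOpenEuler, if_neg]
      rintro ⟨y, hy, rfl : l y = t⟩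
      exact ht ⟨(hconst y hy).ge, (hconst y hy).le⟩
  push Not at hconst
  obtain ⟨y, hy, hxy⟩ := hconst
  have hbeyond : ∀ z ∈ C, (∃ p ∈ C, l p < l z) ∧ ∃ q ∈ C, l z < l q := by
    intro z hz
    obtain ⟨u, hu, huz⟩ : ∃ u ∈ C, l u ≠ l z := by
      by_cases h : l z = l x
      · exact ⟨y, hy, h ▸ hxy⟩
      · exact ⟨x, hx, Ne.symm h⟩
    obtain ⟨ε, hε, h⟩ := (hopen hz).2 u hu
    have hl : l (z + ε • (z - u)) = l z + ε * (l z - l u) := by simp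
    rcases huz.lt_or_gt with huz | huz
    · exact ⟨⟨u, hu, huz⟩, _, h, by rw [hl]; nlinarith⟩
    · exact ⟨⟨_, h, by rw [hl]; nlinarith⟩, u, hu, huz⟩
  have hne : (l '' C).Nonempty := ⟨_, x, hx, rfl⟩
  have hfiber : ∀ t, (C ∩ {x | l x = t}).Nonempty ↔ sInf (l '' C) < t ∧ t < sSup (l '' C) := by
    refine fun t => ⟨?_, fun ⟨h₁, h₂⟩ => ?_⟩
    · rintro ⟨z, hz, rfl : l z = t⟩
      obtain ⟨⟨p, hp, hpz⟩, q, hq, hzq⟩ := hbeyond z hz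
      exact ⟨(csInf_le hb ⟨p, hp, rfl⟩).trans_lt hpz, hzq.trans_le (le_csSup ha ⟨q, hq, rfl⟩)⟩
    · obtain ⟨_, hp, hpt⟩ := exists_lt_of_csInf_lt hne h₁
      obtain ⟨_, hq, htq⟩ := exists_lt_of_lt_csSup hne h₂
      obtain ⟨z, hz, hzt⟩ := (hC.linear_image l).ordConnected.out hp hq ⟨hpt.le, htq.le⟩
      exact ⟨z, hz, hzt⟩
  have hlt := (hfiber (l x)).1 ⟨x, hx, rfl⟩
  convert hasEulerIntegral_Ioo (hlt.1.trans hlt.2) (-relOpenEuler C) using 2 with t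
  · split_ifs with ht
    · have hne_t := (hfiber t).2 ht
      rw [relOpenEuler, relOpenEuler, if_pos hne_t, if_pos ⟨x, hx⟩,
        hC.vectorSpan_inter_fiber hopen l hne_t,
        ← finrank_inf_ker_add_one _ l (vsub_mem_vectorSpan ℝ hy hx) (by simpa [sub_eq_zero]),
        pow_succ]
      ring
    · rw [relOpenEuler, if_neg (mt (hfiber t).1 ht)]
  · simp

/-- The Euler characteristics of the relatively open convex pieces of a partition of a nonempty
compact convex set sum to one. -/
theorem sum_relOpenEuler_eq_one {E : Type*} [NormedAddCommGroup E] [InnerProductSpace ℝ E]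
    [FiniteDimensional ℝ E] {ι : Type*} (s : Finset ι) (D : ι → Set E) (C : Set E)
    (hcomp : IsCompact C) (hconv : Convex ℝ C) (hne : C.Nonempty)
    (hD : ∀ i ∈ s, Convex ℝ (D i)) (hopen : ∀ i ∈ s, D i ⊆ algRelInterior (D i))
    (hsub : ∀ i ∈ s, D i ⊆ C) (hpart : ∀ x ∈ C, ∃! i, i ∈ s ∧ x ∈ D i) :
    ∑ i ∈ s, relOpenEuler (D i) = 1 := by
  induction hd : Module.finrank ℝ (vectorSpan ℝ C) using Nat.strong_induction_on
    generalizing D C with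
  | h d ih =>
  subst hd
  rcases C.subsingleton_or_nontrivial with hsing | ⟨x, hx, y, hy, hxy⟩
  · obtain ⟨x, hx⟩ := hne
    obtain ⟨i, ⟨his, hi⟩, huniq⟩ := hpart x hx
    rw [Finset.sum_eq_single_of_mem i his]
    · rw [relOpenEuler, if_pos ⟨x, hi⟩,
        vectorSpan_of_subsingleton ℝ (hsing.anti (hsub i his)), finrank_bot, pow_zero]
    · intro j hj hji
      rw [relOpenEuler, if_neg]
      rintro ⟨z, hz⟩
      exact hji (huniq j ⟨hj, hsing (hsub j hj hz) hx ▸ hz⟩)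
  let l : E →L[ℝ] ℝ := innerSL ℝ (y - x)
  have hl : l (y - x) ≠ 0 := by
    rw [innerSL_apply_apply, inner_self_ne_zero, sub_ne_zero]
    exact hxy.symm
  have himage : IsCompact (l '' C) := hcomp.image l.continuous
  obtain ⟨a, haC, ha⟩ := hcomp.exists_isMinOn hne l.continuous.continuousOn
  obtain ⟨b, hbC, hb⟩ := hcomp.exists_isMaxOn hne l.continuous.continuousOn
  have hfiber : ∀ t, (C ∩ {z | (l : E →ₗ[ℝ] ℝ) z = t}).Nonempty ↔ l a ≤ t ∧ t ≤ l b := by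
    refine fun t => ⟨?_, fun ht => ?_⟩
    · rintro ⟨z, hz, rfl⟩
      exact ⟨ha hz, hb hz⟩
    · obtain ⟨z, hz, hzt⟩ := (hconv.linear_image (l : E →ₗ[ℝ] ℝ)).ordConnected.out
        ⟨a, haC, rfl⟩ ⟨b, hbC, rfl⟩ ht
      exact ⟨z, hz, hzt⟩
  have hsum : ∀ t, ∑ i ∈ s, relOpenEuler (D i ∩ {z | (l : E →ₗ[ℝ] ℝ) z = t}) =
      if l a ≤ t ∧ t ≤ l b then 1 else 0 := by
    intro t
    split_ifs with ht
    · refine ih _ ?_ _ (C ∩ {z | (l : E →ₗ[ℝ] ℝ) z = t}) ?_ (hconv.inter_fiber _ t)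
        ((hfiber t).2 ht) (fun i hi => (hD i hi).inter_fiber _ t)
        (fun i hi => inter_fiber_subset_algRelInterior (hopen i hi) _ t)
        (fun i hi => Set.inter_subset_inter_left _ (hsub i hi)) ?_ rfl
      · refine ((Submodule.finrank_mono (vectorSpan_inter_fiber_le C _ t)).trans_lt ?_)
        rw [← finrank_inf_ker_add_one _ (l : E →ₗ[ℝ] ℝ) (vsub_mem_vectorSpan ℝ hy hx) hl]
        exact Nat.lt_succ_self _
      · exact hcomp.inter_right (isClosed_eq l.continuous continuous_const)
      · rintro z ⟨hz, hzt⟩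
        obtain ⟨i, hi, huniq⟩ := hpart z hz
        exact ⟨i, ⟨hi.1, hi.2, hzt⟩, fun j hj => huniq j ⟨hj.1, hj.2.1⟩⟩
    · refine Finset.sum_eq_zero fun i hi => ?_
      rw [relOpenEuler, if_neg]
      exact fun h => ht ((hfiber t).1 (h.mono (Set.inter_subset_inter_left _ (hsub i hi))))
  refine HasEulerIntegral.unique
    (HasEulerIntegral.sum fun i hi => hasEulerIntegral_relOpenEuler_fiber (hD i hi) (hopen i hi)
      (l : E →ₗ[ℝ] ℝ) (himage.bddBelow.mono (Set.image_mono (hsub i hi)))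
      (himage.bddAbove.mono (Set.image_mono (hsub i hi)))) ?_
  simp only [hsum]
  exact hasEulerIntegral_Icc (ha hbC) 1

end EulerRelation

section Faces

/-- The points `y` of `P` such that the segment from `y` to `x` can be prolonged in `P` beyond
`x`; for `P` convex and `x ∈ P` this is the smallest face of `P` containing `x`. -/
def faceAt {E : Type*} [AddCommGroup E] [Module ℝ E] (P : Set E) (x : E) : Set E :=
  {y | y ∈ P ∧ ∃ ε : ℝ, 0 < ε ∧ x + ε • (x - y) ∈ P}

variable {E : Type*} [AddCommGroup E] [Module ℝ E] {P F : Set E} {x : E}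

theorem Convex.convex_faceAt (hP : Convex ℝ P) (hx : x ∈ P) : Convex ℝ (faceAt P x) := by
  rintro y ⟨hy, ε, hε, hyε⟩ z ⟨hz, δ, hδ, hzδ⟩ a b ha hb hab
  have hm := lt_min hε hδ
  refine ⟨hP hy hz ha hb hab, min ε δ, hm, ?_⟩
  convert hP (hP.add_smul_mem_of_le hx hε hyε hm.le (min_le_left _ _))
    (hP.add_smul_mem_of_le hx hδ hzδ hm.le (min_le_right _ _)) ha hb hab using 1
  obtain rfl : b = 1 - a := by linarith
  module

theorem Convex.isExtreme_faceAt (hP : Convex ℝ P) (x : E) : IsExtreme ℝ P (faceAt P x) := by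
  refine ⟨fun y hy => hy.1, ?_⟩
  rintro y hy z hz _ ⟨_, ε, hε, hp⟩ ⟨a, b, ha, hb, hab, rfl⟩
  refine ⟨hy, ε * a / (1 + ε * b), by positivity, ?_⟩
  convert hP hp hz (a := 1 / (1 + ε * b)) (b := ε * b / (1 + ε * b)) (by positivity)
    (by positivity) (by field_simp) using 1
  obtain rfl : a = 1 - b := by linarith
  match_scalars <;> field_simp <;> ring

theorem mem_algRelInterior_faceAt (hx : x ∈ P) :
    x ∈ algRelInterior (faceAt P x) := by
  refine ⟨⟨hx, 1, one_pos, by simpa using hx⟩, ?_⟩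
  rintro y ⟨hy, ε, hε, hp⟩
  refine ⟨ε, hε, hp, ε⁻¹, by positivity, ?_⟩
  convert hy using 1
  match_scalars
  · field_simp
    ring
  · field_simp

theorem IsExtreme.eq_faceAt (hF : IsExtreme ℝ P F) (hx : x ∈ algRelInterior F) :
    F = faceAt P x := by
  refine Set.Subset.antisymm (fun y hy => ?_) ?_
  · obtain ⟨ε, hε, h⟩ := hx.2 y hy
    exact ⟨hF.subset hy, ε, hε, hF.subset h⟩
  · rintro y ⟨hy, ε, hε, hp⟩
    refine hF.left_mem_of_mem_openSegment hy hp hx.1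
      ⟨ε / (1 + ε), 1 / (1 + ε), by positivity, by positivity, by field_simp; ring, ?_⟩
    match_scalars
    · field_simp
      ring
    · field_simp

theorem IsExtreme.eq_convexHull_filter {V : Finset E} [DecidablePred (· ∈ F)]
    (hF : IsExtreme ℝ (convexHull ℝ (V : Set E)) F) (hconv : Convex ℝ F) :
    F = convexHull ℝ (V.filter (· ∈ F) : Set E) := by
  refine Set.Subset.antisymm (fun y hy => ?_)
    (convexHull_min (fun z hz => (Finset.mem_filter.1 hz).2) hconv)
  have hsdiff : convexHull ℝ (V.filter (· ∉ F) : Set E) ⊆ convexHull ℝ (V : Set E) \ F :=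
    convexHull_min (fun z hz => ⟨subset_convexHull ℝ _ (Finset.mem_filter.1 hz).1,
      (Finset.mem_filter.1 hz).2⟩) (hF.convex_sdiff (convex_convexHull ℝ _))
  have hV : (V : Set E) = (V.filter (· ∈ F) : Set E) ∪ (V.filter (· ∉ F) : Set E) := by
    rw [← Finset.coe_union, Finset.filter_union_filter_not_eq]
  have hyV := hF.subset hy
  rcases (V.filter (· ∉ F) : Set E).eq_empty_or_nonempty with h₂ | h₂
  · rwa [hV, h₂, Set.union_empty] at hyV
  rcases (V.filter (· ∈ F) : Set E).eq_empty_or_nonempty with h₁ | h₁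
  · rw [hV, h₁, Set.empty_union] at hyV
    exact absurd hy (hsdiff hyV).2
  rw [hV, convexHull_union h₁ h₂, mem_convexJoin] at hyV
  obtain ⟨p, hp, q, hq, hpq⟩ := hyV
  rw [← insert_endpoints_openSegment] at hpq
  rcases hpq with rfl | rfl | hpq
  · exact hp
  · exact absurd hy (hsdiff hq).2
  · have hpP := convexHull_mono (Finset.coe_subset.2 (Finset.filter_subset _ _)) hp
    exact absurd (hF.right_mem_of_mem_openSegment hpP (hsdiff hq).1 hy hpq) (hsdiff hq).2

end Faces

section PolytopeFaces

variable {n : ℕ} {P : Set (EuclideanSpace ℝ (Fin n))} {V : Finset (EuclideanSpace ℝ (Fin n))}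

theorem isPolyFace_convexHull (hV : V.Nonempty) :
    IsPolyFace (convexHull ℝ (V : Set (EuclideanSpace ℝ (Fin n)))) (convexHull ℝ V) :=
  ⟨by simpa using hV, IsExtreme.rfl, convex_convexHull ℝ _,
    V.finite_toSet.isClosed_convexHull ℝ⟩

theorem IsPolyFace.isPolyFace_iff {τ σ : Set (EuclideanSpace ℝ (Fin n))} (hτ : IsPolyFace P τ) :
    IsPolyFace τ σ ↔ IsPolyFace P σ ∧ σ ⊆ τ :=
  ⟨fun h => ⟨⟨h.1, hτ.2.1.trans h.2.1, h.2.2⟩, h.2.1.subset⟩,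
    fun h => ⟨h.1.1, h.1.2.1.mono hτ.2.1.subset h.2, h.1.2.2⟩⟩

theorem isPolyFace_faceAt {x : EuclideanSpace ℝ (Fin n)}
    (hx : x ∈ convexHull ℝ (V : Set (EuclideanSpace ℝ (Fin n)))) :
    IsPolyFace (convexHull ℝ V) (faceAt (convexHull ℝ V) x) := by
  have hconv := (convex_convexHull ℝ (V : Set (EuclideanSpace ℝ (Fin n)))).convex_faceAt hx
  have hext := (convex_convexHull ℝ (V : Set (EuclideanSpace ℝ (Fin n)))).isExtreme_faceAt x
  refine ⟨⟨x, (mem_algRelInterior_faceAt hx).1⟩, hext, hconv, ?_⟩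
  rw [hext.eq_convexHull_filter hconv]
  exact (Finset.finite_toSet _).isClosed_convexHull ℝ

/-- **Euler's relation** for the nonempty faces of a polytope, the polytope included. -/
theorem sum_neg_one_pow_faceDim_eq_one (hV : V.Nonempty)
    (Δ : Finset (Set (EuclideanSpace ℝ (Fin n))))
    (hΔ : ∀ F, F ∈ Δ ↔ IsPolyFace (convexHull ℝ (V : Set (EuclideanSpace ℝ (Fin n)))) F) :
    ∑ σ ∈ Δ, (-1 : ℤ) ^ faceDim σ = 1 := by
  have hconv := convex_convexHull ℝ (V : Set (EuclideanSpace ℝ (Fin n)))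
  refine Eq.trans ?_ (sum_relOpenEuler_eq_one Δ algRelInterior (convexHull ℝ (V : Set _))
    (V.finite_toSet.isCompact_convexHull ℝ) hconv (by simpa using hV)
    (fun F hF => ((hΔ F).1 hF).2.2.1.convex_algRelInterior)
    (fun F hF => ((hΔ F).1 hF).2.2.1.algRelInterior_subset_algRelInterior)
    (fun F hF => (algRelInterior_subset F).trans ((hΔ F).1 hF).2.1.subset)
    (fun x hx => ⟨faceAt _ x, ⟨(hΔ _).2 (isPolyFace_faceAt hx), mem_algRelInterior_faceAt hx⟩,
      fun F hF => ((hΔ F).1 hF.1).2.1.eq_faceAt hF.2⟩))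
  refine Finset.sum_congr rfl fun F hF => ?_
  obtain ⟨hne, hext, hFconv, -⟩ := (hΔ F).1 hF
  have hrel : (algRelInterior F).Nonempty := by
    rw [hext.eq_convexHull_filter hFconv] at hne ⊢
    exact exists_mem_algRelInterior_convexHull _ 
      (Finset.coe_nonempty.1 (convexHull_nonempty_iff.1 hne))
  rw [relOpenEuler, if_pos hrel, hFconv.vectorSpan_algRelInterior hrel, faceDim]

/-- The smallest member of `Δ` containing both `v` and `σ`. -/
def joinFace (Δ : Finset (Set (EuclideanSpace ℝ (Fin n)))) (v : EuclideanSpace ℝ (Fin n))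
    (σ : Set (EuclideanSpace ℝ (Fin n))) : Set (EuclideanSpace ℝ (Fin n)) :=
  ⋂₀ {F | F ∈ Δ ∧ v ∈ F ∧ σ ⊆ F}

variable {Δ : Finset (Set (EuclideanSpace ℝ (Fin n)))} {v : EuclideanSpace ℝ (Fin n)}
  {σ τ : Set (EuclideanSpace ℝ (Fin n))}

theorem mem_joinFace : v ∈ joinFace Δ v σ := fun _ hF => hF.2.1

theorem subset_joinFace : σ ⊆ joinFace Δ v σ := fun _ hx _ hF => hF.2.2 hx

theorem joinFace_subset (hτ : τ ∈ Δ) (hv : v ∈ τ) (hσ : σ ⊆ τ) : joinFace Δ v σ ⊆ τ :=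
  Set.sInter_subset_of_mem ⟨hτ, hv, hσ⟩

theorem isPolyFace_joinFace (hΔ : ∀ F, F ∈ Δ ↔ IsPolyFace P F) (hP : P ∈ Δ) (hv : v ∈ P)
    (hσ : σ ⊆ P) : IsPolyFace P (joinFace Δ v σ) :=
  ⟨⟨v, mem_joinFace⟩,
    isExtreme_sInter ⟨P, hP, hv, hσ⟩ fun F hF => ((hΔ F).1 hF.1).2.1,
    convex_sInter fun F hF => ((hΔ F).1 hF.1).2.2.1,
    isClosed_sInter fun F hF => ((hΔ F).1 hF.1).2.2.2⟩

theorem mem_vertexPerp_iff (hjoin : ∀ σ ∈ Δ, joinFace Δ v σ ∈ Δ) (hτ : τ ∈ Δ) (hv : v ∈ τ) :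
    σ ∈ vertexPerp Δ v τ ↔ σ ∈ Δ ∧ joinFace Δ v σ = τ := by
  refine (@Finset.mem_filter _ _ (Classical.decPred _) _ _).trans <|
    and_congr_right fun hσ => ⟨fun ⟨hστ, h⟩ => ?_, ?_⟩
  · by_contra hne
    exact h _ (hjoin σ hσ) (joinFace_subset hτ hv hστ) hne mem_joinFace subset_joinFace
  · rintro rfl
    exact ⟨subset_joinFace, fun ρ hρ hρτ hne hvρ hσρ =>
      hne (hρτ.antisymm (joinFace_subset hρ hvρ hσρ))⟩

theorem sum_faces_eq_sum_vertexPerp (hjoin : ∀ σ ∈ Δ, joinFace Δ v σ ∈ Δ) (hτ : τ ∈ Δ)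
    (hv : v ∈ τ) (f : Set (EuclideanSpace ℝ (Fin n)) → ℤ) :
    ∑ σ ∈ Δ with σ ⊆ τ, f σ = ∑ ρ ∈ Δ with v ∈ ρ ∧ ρ ⊆ τ, ∑ σ ∈ vertexPerp Δ v ρ, f σ := by
  rw [← Finset.sum_fiberwise_of_maps_to (t := {ρ ∈ Δ | v ∈ ρ ∧ ρ ⊆ τ}) (g := joinFace Δ v)]
  · refine Finset.sum_congr rfl fun ρ hρ => Finset.sum_congr ?_ fun _ _ => rfl
    obtain ⟨hρΔ, hvρ, hρτ⟩ := Finset.mem_filter.1 hρ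
    ext σ
    rw [mem_vertexPerp_iff hjoin hρΔ hvρ, Finset.mem_filter, Finset.mem_filter]
    refine ⟨fun h => ⟨h.1.1, h.2⟩, fun h => ⟨⟨h.1, ?_⟩, h.2⟩⟩
    exact subset_joinFace.trans (h.2.subset.trans hρτ)
  · intro σ hσ
    obtain ⟨hσΔ, hστ⟩ := Finset.mem_filter.1 hσ
    exact Finset.mem_filter.2 ⟨hjoin σ hσΔ, mem_joinFace, joinFace_subset hτ hv hστ⟩

theorem sum_vertexPerp_eq_ite (hjoin : ∀ σ ∈ Δ, joinFace Δ v σ ∈ Δ)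
    (hvΔ : ({v} : Set (EuclideanSpace ℝ (Fin n))) ∈ Δ)
    {f : Set (EuclideanSpace ℝ (Fin n)) → ℤ}
    (hf : ∀ τ ∈ Δ, ∑ σ ∈ Δ with σ ⊆ τ, f σ = 1) (hτ : τ ∈ Δ) (hv : v ∈ τ) :
    ∑ σ ∈ vertexPerp Δ v τ, f σ = if τ = {v} then 1 else 0 := by
  induction hN : ({σ ∈ Δ | σ ⊆ τ} : Finset _).card using Nat.strong_induction_on
    generalizing τ with
  | h N ih =>
  subst hN
  have hτ' : τ ∈ ({ρ ∈ Δ | v ∈ ρ ∧ ρ ⊆ τ} : Finset _) :=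
    Finset.mem_filter.2 ⟨hτ, hv, subset_rfl⟩
  have hone : ∑ ρ ∈ Δ with v ∈ ρ ∧ ρ ⊆ τ, (if ρ = {v} then (1 : ℤ) else 0) = 1 := by
    rw [Finset.sum_ite_eq', if_pos]
    exact Finset.mem_filter.2 ⟨hvΔ, rfl, Set.singleton_subset_iff.2 hv⟩
  have htotal := (sum_faces_eq_sum_vertexPerp hjoin hτ hv f).symm.trans
    ((hf τ hτ).trans hone.symm)
  rw [← sub_eq_zero, ← Finset.sum_sub_distrib, Finset.sum_eq_single_of_mem τ hτ'] at htotal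
  · exact sub_eq_zero.1 htotal
  intro ρ hρ hne
  obtain ⟨hρΔ, hvρ, hρτ⟩ := Finset.mem_filter.1 hρ
  refine sub_eq_zero.2 (ih _ (Finset.card_lt_card ?_) hρΔ hvρ rfl)
  refine ⟨Finset.monotone_filter_right _ fun σ _ h => h.trans hρτ, fun h => hne ?_⟩
  exact hρτ.antisymm (Finset.mem_filter.1 (h (Finset.mem_filter.2 ⟨hτ, subset_rfl⟩))).2

end PolytopeFaces

/-- **Partition of the face complex by vertex stars and its Euler characteristics.**
Let `Δ` be the (finite) complex of nonempty faces of an `n`-dimensional polytope `P`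
and fix a vertex `v`.  Then the sets `τ^⊥`, for `τ` ranging over the faces containing
`v`, partition `Δ`, and the Euler characteristic `χ(τ^⊥) = ∑_{σ ∈ τ^⊥} (-1)^{dim σ}`
vanishes unless `τ = {v}`, in which case it equals `1`. -/
theorem vertexPerp_partition_and_euler_char
    {n : ℕ} (P : Set (EuclideanSpace ℝ (Fin n)))
    (V : Finset (EuclideanSpace ℝ (Fin n)))
    (hP : P = convexHull ℝ (V : Set (EuclideanSpace ℝ (Fin n))))
    (hfull : faceDim P = n)
    (Δ : Finset (Set (EuclideanSpace ℝ (Fin n))))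
    (hΔ : ∀ F : Set (EuclideanSpace ℝ (Fin n)), F ∈ Δ ↔ IsPolyFace P F)
    (v : EuclideanSpace ℝ (Fin n)) (hv : ({v} : Set (EuclideanSpace ℝ (Fin n))) ∈ Δ) :
    (∀ σ ∈ Δ, ∃! τ : Set (EuclideanSpace ℝ (Fin n)),
        τ ∈ Δ ∧ v ∈ τ ∧ σ ∈ vertexPerp Δ v τ) ∧
    (∀ τ ∈ Δ, v ∈ τ →
        (∑ σ ∈ vertexPerp Δ v τ, (-1 : ℤ) ^ faceDim σ)
          = if τ = ({v} : Set (EuclideanSpace ℝ (Fin n))) then 1 else 0) := by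
  subst hP
  have hvP : v ∈ convexHull ℝ (V : Set (EuclideanSpace ℝ (Fin n))) :=
    ((hΔ _).1 hv).2.1.subset rfl
  have hV : V.Nonempty := Finset.coe_nonempty.1 (convexHull_nonempty_iff.1 ⟨v, hvP⟩)
  have hjoin : ∀ σ ∈ Δ, joinFace Δ v σ ∈ Δ := fun σ hσ => (hΔ _).2 <|
    isPolyFace_joinFace hΔ ((hΔ _).2 (isPolyFace_convexHull hV)) hvP ((hΔ σ).1 hσ).2.1.subset
  refine ⟨fun σ hσ => ⟨joinFace Δ v σ, ⟨hjoin σ hσ, mem_joinFace, ?_⟩, fun τ hτ => ?_⟩,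
    fun τ hτ hvτ => sum_vertexPerp_eq_ite hjoin hv (fun ρ hρ => ?_) hτ hvτ⟩
  · exact (mem_vertexPerp_iff hjoin (hjoin σ hσ) mem_joinFace).2 ⟨hσ, rfl⟩
  · exact ((mem_vertexPerp_iff hjoin hτ.1 hτ.2.1).1 hτ.2.2).2.symm
  · have hface := (hΔ ρ).1 hρ
    have hρV := hface.2.1.eq_convexHull_filter hface.2.2.1
    refine sum_neg_one_pow_faceDim_eq_one (V := V.filter (· ∈ ρ)) ?_ _ fun σ => ?_
    · have hne := hface.1
      rw [hρV] at hne
      exact Finset.coe_nonempty.1 (convexHull_nonempty_iff.1 hne)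
    · rw [← hρV, hface.isPolyFace_iff, Finset.mem_filter, hΔ]
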